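/- Let A be a partition of length at most l and J a subdivision of {1,…,l} into consecutive intervals I_1,…,I_ι. Then (i) G_J(A) has positive multiplicity in (s_A)^{L(l)}, and (ii) G_J(A) + χ_J(A) is a partition and has positive multiplicity in (s_A)^{L(l)−1}. -/

import Mathlib

open Finset MvPolynomial

/-- `hp l k` is the complete homogeneous symmetric polynomial `h_k` in `l` variables,
interpreted as `0` for negative `k` (and `h_0 = 1`). -/
noncomputable def hp (l : ℕ) (k : ℤ) : MvPolynomial (Fin l) ℤ :=
  if 0 ≤ k then MvPolynomial.hsymm (Fin l) ℤ k.toNat else 0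

/-- The Schur polynomial of a partition (given as a weakly decreasing `l`-tuple) in `l`
variables, defined by the Jacobi–Trudi determinant `s_A = det (h_{A i - i + j})`. -/
noncomputable def schur (l : ℕ) (A : Fin l → ℕ) : MvPolynomial (Fin l) ℤ :=
  Matrix.det (Matrix.of fun i j : Fin l => hp l ((A i : ℤ) + (j : ℕ) - (i : ℕ)))

/-- The Vandermonde alternant `a_δ = det (x_i ^ (l - 1 - j))`. -/
noncomputable def vdm (l : ℕ) : MvPolynomial (Fin l) ℤ :=
  Matrix.det (Matrix.of fun i j : Fin l => (X i : MvPolynomial (Fin l) ℤ) ^ (l - 1 - (j : ℕ)))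

/-- The multiplicity (coefficient) of the Schur polynomial `s_B` in the expansion of a
symmetric polynomial `P` in the basis of Schur polynomials of partitions of length at most
`l`: it equals the coefficient of the monomial `x ^ (B + δ)` in the alternating polynomial
`P * a_δ`, where `δ = (l-1, l-2, …, 0)`. -/
noncomputable def schurMult (l : ℕ) (B : Fin l → ℕ) (P : MvPolynomial (Fin l) ℤ) : ℤ :=
  MvPolynomial.coeff (Finsupp.equivFunOnFinite.symm fun i : Fin l => B i + (l - 1 - (i : ℕ)))
    (P * vdm l)

/-- The Littlewood–Richardson coefficient `c^C_{A,B}` for partitions of length at most `l`,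
as the multiplicity of `s_C` in `s_A * s_B` (this agrees with the structure constants of the
ring of symmetric functions in the Schur basis). -/
noncomputable def lrCoeff (l : ℕ) (A B C : Fin l → ℕ) : ℤ :=
  schurMult l C (schur l A * schur l B)

/-- Dominance: every partial sum of `A` is at least the corresponding partial sum of `B`. -/
def Dom (l : ℕ) (A B : Fin l → ℕ) : Prop :=
  ∀ r : ℕ, ∑ i ∈ Finset.univ.filter (fun i : Fin l => (i : ℕ) < r), B i ≤
    ∑ i ∈ Finset.univ.filter (fun i : Fin l => (i : ℕ) < r), A i

/-- The Young diagram of `A` (0-based): boxes `(i, j)` with `j < A i`. -/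
def YD (l : ℕ) (A : Fin l → ℕ) : Set (Fin l × ℕ) := {p | p.2 < A p.1}

/-- Size of block `I_j` of the subdivision of `{1,…,l}` encoded by the monotone
surjection `f : Fin l → Fin ι` (whose fibers are the consecutive blocks). -/
def bsize (l ι : ℕ) (f : Fin l → Fin ι) (j : Fin ι) : ℕ :=
  (Finset.univ.filter fun i => f i = j).card

/-- The first (0-based) position of block `I_j`. -/
def bstart (l ι : ℕ) (f : Fin l → Fin ι) (j : Fin ι) : ℕ :=
  (Finset.univ.filter fun i => f i < j).card

/-- One past the last (0-based) position of block `I_j`. -/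
def bend (l ι : ℕ) (f : Fin l → Fin ι) (j : Fin ι) : ℕ :=
  (Finset.univ.filter fun i => f i ≤ j).card

/-- The sum `|A[I_j]|` of the entries of `A` over block `I_j`. -/
def bsum (l ι : ℕ) (f : Fin l → Fin ι) (A : Fin l → ℕ) (j : Fin ι) : ℕ :=
  ∑ i ∈ Finset.univ.filter (fun i => f i = j), A i

/-- `L(l) = lcm {1, …, l}`. -/
def Lnum (l : ℕ) : ℕ := (Finset.Icc 1 l).lcm id

/-- The partition `G_J(A)`: constant on each block `I_j`, with value `(L(l)/|I_j|)·|A[I_j]|`. -/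
def GJ (l ι : ℕ) (f : Fin l → Fin ι) (A : Fin l → ℕ) : Fin l → ℕ :=
  fun i => (Lnum l / bsize l ι f (f i)) * bsum l ι f A (f i)

/-- `A` extended by zero beyond its `l` entries. -/
def pad (l : ℕ) (A : Fin l → ℕ) (m : ℕ) : ℕ := if h : m < l then A ⟨m, h⟩ else 0

/-- The position symmetric to `i` within its block (reversal of the block). -/
def reflIdx (l ι : ℕ) (f : Fin l → Fin ι) (i : Fin l) : ℕ :=
  bstart l ι f (f i) + bend l ι f (f i) - 1 - (i : ℕ)

/-- `χ_J(A)`: on each block, the negatives of the entries of `A` in reversed order. -/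
def chiJ (l ι : ℕ) (f : Fin l → Fin ι) (A : Fin l → ℕ) : Fin l → ℤ :=
  fun i => -(pad l A (reflIdx l ι f i) : ℤ)


section JT

/-- The monomial `x ^ γ`. -/
noncomputable def xpow {l : ℕ} (γ : Fin l → ℕ) : MvPolynomial (Fin l) ℤ := ∏ c, X c ^ γ c

/-- Antisymmetrization. -/
noncomputable def alt {l : ℕ} (P : MvPolynomial (Fin l) ℤ) : MvPolynomial (Fin l) ℤ :=
  ∑ w : Equiv.Perm (Fin l), (Equiv.Perm.sign w : ℤ) • rename w P

/-- The staircase. -/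
def stair (l : ℕ) : Fin l → ℕ := fun i => l - 1 - (i : ℕ)

theorem alt_xpow_eq_det {l : ℕ} (γ : Fin l → ℕ) :
    alt (xpow γ) = Matrix.det (Matrix.of fun i j : Fin l =>
      (X i : MvPolynomial (Fin l) ℤ) ^ γ j) := by
  rw [Matrix.det_apply, alt]
  refine Finset.sum_congr rfl fun w _ => ?_
  simp [xpow, map_prod, Units.smul_def]

theorem vdm_eq_alt (l : ℕ) : vdm l = alt (xpow (stair l)) := by
  rw [alt_xpow_eq_det]; rfl

theorem hsymm_eq_coeff (l n : ℕ) : hsymm (Fin l) ℤ n =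
    PowerSeries.coeff n (∏ c : Fin l,
      PowerSeries.mk (fun m => (X c : MvPolynomial (Fin l) ℤ) ^ m)) := by
  rw [PowerSeries.coeff_prod, hsymm]
  simp only [PowerSeries.coeff_mk]
  refine Finset.sum_bij' (fun s _ => Multiset.toFinsupp s.1)
    (fun d hd => (⟨Finsupp.toMultiset d, ?_⟩ : Sym (Fin l) n)) ?_ ?_ ?_ ?_ ?_
  · have := (Finset.mem_finsuppAntidiag.1 hd).1
    rw [Finsupp.card_toMultiset, ← this, Finsupp.sum_fintype]
    · rfl
    · simp
  · intro s _
    rw [Finset.mem_finsuppAntidiag]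
    refine ⟨?_, Finset.subset_univ _⟩
    change ∑ c, Multiset.count c s.1 = n
    rw [Multiset.sum_count_eq_card (by simp)]
    exact s.2
  · intro _ _; exact Finset.mem_univ _
  · intro s _
    apply Subtype.ext
    simp
  · intro d hd
    simp
  · intro s _
    rw [Finset.prod_multiset_map_count]
    simp only [Multiset.toFinsupp_apply]
    apply Finset.prod_subset (Finset.subset_univ _)
    intro x _ hx
    rw [Multiset.mem_toFinset] at hx
    have h0 : Multiset.count x s.1 = 0 := Multiset.count_eq_zero_of_notMem hx
    exact (congrArg (fun e => (X x : MvPolynomial (Fin l) ℤ) ^ e) h0).trans (pow_zero _)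

theorem geom_mul {R : Type*} [CommRing R] (a : R) :
    PowerSeries.mk (fun m => a ^ m) * (1 - PowerSeries.C a * PowerSeries.X) = 1 := by
  ext n
  rw [mul_sub, mul_one, ← mul_assoc]
  cases n with
  | zero => simp
  | succ n => 
    rw [map_sub, PowerSeries.coeff_succ_mul_X, PowerSeries.coeff_mul_C]
    simp [pow_succ]

/-- Product of all linear factors other than the one of index c, as a polynomial. -/
noncomputable def omitProd (l : ℕ) (c : Fin l) : Polynomial (MvPolynomial (Fin l) ℤ) :=
  ∏ d ∈ Finset.univ.erase c, (1 - Polynomial.C (X d) * Polynomial.X)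

theorem omitProd_natDegree (l : ℕ) (c : Fin l) : (omitProd l c).natDegree ≤ l - 1 := by
  unfold omitProd
  refine (Polynomial.natDegree_prod_le _ _).trans ?_
  calc _ ≤ ∑ d ∈ Finset.univ.erase c, 1 := by
        refine Finset.sum_le_sum fun d _ => ?_
        refine (Polynomial.natDegree_sub_le _ _).trans ?_
        simp only [Polynomial.natDegree_one, zero_le, sup_of_le_right]
        simp
    _ ≤ l - 1 := by simp

theorem hs_omit (l : ℕ) (c : Fin l) :
    (∏ c : Fin l, PowerSeries.mk (fun m => (X c : MvPolynomial (Fin l) ℤ) ^ m)) *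
      (omitProd l c : PowerSeries (MvPolynomial (Fin l) ℤ)) =
    PowerSeries.mk (fun m => (X c : MvPolynomial (Fin l) ℤ) ^ m) := by
  have : (omitProd l c : PowerSeries (MvPolynomial (Fin l) ℤ)) =
      ∏ d ∈ Finset.univ.erase c, (1 - PowerSeries.C (X d) * PowerSeries.X) := by
    unfold omitProd
    rw [← Polynomial.coeToPowerSeries.ringHom_apply, map_prod]
    simp
  rw [this, ← Finset.mul_prod_erase Finset.univ _ (Finset.mem_univ c), mul_assoc,
    ← Finset.prod_mul_distrib]
  simp [geom_mul]

theorem hp_sum (l : ℕ) (c : Fin l) (m : ℕ) :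
    ∑ j : Fin l, hp l ((m : ℤ) - ((l - 1 : ℕ) : ℤ) + (j : ℕ)) * (omitProd l c).coeff (l - 1 - (j : ℕ)) =
      (X c : MvPolynomial (Fin l) ℤ) ^ m := by
  have h := congrArg (PowerSeries.coeff m) (hs_omit l c)
  rw [PowerSeries.coeff_mul, PowerSeries.coeff_mk] at h
  rw [← h]
  have hl : 0 < l := c.pos
  set F : ℕ → MvPolynomial (Fin l) ℤ := fun e => hp l ((m : ℤ) - e) * (omitProd l c).coeff e with hF
  have e1 : ∑ e ∈ Finset.range l, F e = ∑ e ∈ Finset.range (l + m + 1), F e := by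
    apply Finset.sum_subset
    · intro x; simp only [Finset.mem_range]; omega
    · intro x _ hx
      simp only [Finset.mem_range] at hx
      have := omitProd_natDegree l c
      rw [hF]
      simp only
      rw [Polynomial.coeff_eq_zero_of_natDegree_lt (by omega), mul_zero]
  have e2 : ∑ e ∈ Finset.range (m + 1), F e = ∑ e ∈ Finset.range (l + m + 1), F e := by
    apply Finset.sum_subset
    · intro x; simp only [Finset.mem_range]; omega
    · intro x _ hx
      simp only [Finset.mem_range] at hx
      rw [hF]
      simp only [hp]
      rw [if_neg (by omega), zero_mul]
  rw [← Finset.Nat.sum_antidiagonal_swap, Finset.Nat.sum_antidiagonal_eq_sum_range_succ_mk]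
  simp only [Prod.swap, ← hsymm_eq_coeff, Polynomial.coeff_coe]
  have e3 : ∑ k ∈ Finset.range m.succ, hsymm (Fin l) ℤ (m - k) * (omitProd l c).coeff k =
      ∑ e ∈ Finset.range (m + 1), F e := by
    refine Finset.sum_congr rfl fun e he => ?_
    simp only [Finset.mem_range] at he
    rw [hF]
    simp only [hp]
    rw [if_pos (by omega)]
    congr 2
    omega
  rw [e3, e2, ← e1, ← Finset.sum_range_reflect, Finset.sum_range]
  refine Finset.sum_congr rfl fun j _ => ?_
  rw [hF]
  simp only
  congr 2
  have := j.2
  omega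

theorem det_stair (l : ℕ) : schur l (fun _ => 0) = 1 := by
  unfold schur
  rw [Matrix.det_of_isUpperTriangular]
  · simp [hp]
  · intro i j hij
    have hij : (j : ℕ) < i := hij
    simp only [Matrix.of_apply, hp]
    rw [if_neg]
    push_cast
    omega

theorem schur_mul_aux (l : ℕ) (A : Fin l → ℕ) :
    schur l A * Matrix.det (Matrix.of fun j c : Fin l => (omitProd l c).coeff (l - 1 - (j : ℕ))) =
      alt (xpow (fun i => A i + stair l i)) := by
  unfold schur
  rw [← Matrix.det_mul, alt_xpow_eq_det, ← Matrix.det_transpose]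
  congr 1
  ext1 c i
  rw [Matrix.transpose_apply, Matrix.mul_apply]
  simp only [Matrix.of_apply]
  rw [← hp_sum l c]
  refine Finset.sum_congr rfl fun j _ => ?_
  congr 2
  have := i.2
  simp only [stair]
  omega

theorem schur_mul_vdm (l : ℕ) (A : Fin l → ℕ) :
    schur l A * vdm l = alt (xpow (fun i => A i + stair l i)) := by
  rw [← schur_mul_aux, vdm_eq_alt]
  have := schur_mul_aux l (fun _ => 0)
  rw [det_stair, one_mul] at this
  rw [this]
  simp

end JT

section KPoly

/-- Number of elements of `S` below `m`. -/
def pc {l : ℕ} (S : Finset (Fin l)) (m : ℕ) : ℕ := (S.filter (fun c : Fin l => (c : ℕ) < m)).card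

/-- Column order. -/
def colLE {l : ℕ} (S' S : Finset (Fin l)) : Prop := ∀ m, pc S m ≤ pc S' m

theorem pc_succ {l : ℕ} (S : Finset (Fin l)) (c : Fin l) :
    pc S ((c : ℕ) + 1) = pc S c + (if c ∈ S then 1 else 0) := by
  unfold pc
  have : S.filter (fun d : Fin l => (d : ℕ) < (c : ℕ) + 1) =
      S.filter (fun d : Fin l => (d : ℕ) < (c : ℕ)) ∪ S.filter (fun d : Fin l => d = c) := by
    ext d
    simp only [Finset.mem_filter, Finset.mem_union, Fin.ext_iff]
    constructor
    · rintro ⟨h1, h2⟩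
      by_cases h : (d : ℕ) < c
      · exact Or.inl ⟨h1, h⟩
      · exact Or.inr ⟨h1, by omega⟩
    · rintro (⟨h1, h2⟩ | ⟨h1, h2⟩) <;> exact ⟨h1, by omega⟩
  rw [this, Finset.card_union_of_disjoint]
  · congr 1
    rw [Finset.filter_eq']
    split_ifs <;> simp
  · rw [Finset.disjoint_left]
    intro d h1 h2
    simp only [Finset.mem_filter] at h1 h2
    rw [h2.2] at h1
    omega

/-- Swapping in a set. -/
def swS {l : ℕ} (i j : Fin l) (S : Finset (Fin l)) : Finset (Fin l) :=
  S.map (Equiv.swap i j).toEmbedding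

theorem mem_swS {l : ℕ} (i j : Fin l) (S : Finset (Fin l)) (c : Fin l) :
    c ∈ swS i j S ↔ Equiv.swap i j c ∈ S := by
  unfold swS
  rw [Finset.mem_map_equiv, Equiv.symm_swap]

theorem swS_swS {l : ℕ} (i j : Fin l) (S : Finset (Fin l)) : swS i j (swS i j S) = S := by
  ext c; simp [mem_swS]

theorem i_mem_swS {l : ℕ} (i j : Fin l) (S : Finset (Fin l)) : i ∈ swS i j S ↔ j ∈ S := by
  simp [mem_swS]

theorem j_mem_swS {l : ℕ} (i j : Fin l) (S : Finset (Fin l)) : j ∈ swS i j S ↔ i ∈ S := by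
  simp [mem_swS]

theorem swS_eq {l : ℕ} (i j : Fin l) (S : Finset (Fin l)) (h : i ∈ S ↔ j ∈ S) : swS i j S = S := by
  ext c
  rw [mem_swS]
  by_cases h1 : c = i
  · subst h1; simp [h]
  by_cases h2 : c = j
  · subst h2; simp [h]
  rw [Equiv.swap_apply_of_ne_of_ne h1 h2]

theorem pc_swS {l : ℕ} (i j : Fin l) (hij : (j : ℕ) = i + 1) (S : Finset (Fin l)) (m : ℕ)
    (hm : m ≠ (i : ℕ) + 1) : pc (swS i j S) m = pc S m := by
  unfold pc swS
  rw [Finset.filter_map, Finset.card_map]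
  congr 1
  ext c
  simp only [Finset.mem_filter, Function.comp, Equiv.coe_toEmbedding, and_congr_right_iff]
  intro _
  by_cases h1 : c = i
  · subst h1; simp; omega
  by_cases h2 : c = j
  · subst h2; simp; omega
  rw [Equiv.swap_apply_of_ne_of_ne h1 h2]

/-- Replace `i` by `j` if possible. -/
def hat {l : ℕ} (i j : Fin l) (S : Finset (Fin l)) : Finset (Fin l) :=
  if i ∈ S ∧ j ∉ S then swS i j S else S

theorem colLE_iff {l : ℕ} (i j : Fin l) (_hij : (j : ℕ) = i + 1) (S' S : Finset (Fin l)) :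
    colLE S' S ↔ (∀ m, m ≠ (i : ℕ) + 1 → pc S m ≤ pc S' m) ∧
      pc S i + (if i ∈ S then 1 else 0) ≤ pc S' i + (if i ∈ S' then 1 else 0) := by
  rw [← pc_succ, ← pc_succ]
  constructor
  · intro h; exact ⟨fun m _ => h m, h _⟩
  · rintro ⟨h1, h2⟩ m
    by_cases hm : m = (i : ℕ) + 1
    · subst hm; exact h2
    · exact h1 m hm

theorem pc_two {l : ℕ} (i j : Fin l) (hij : (j : ℕ) = i + 1) (S : Finset (Fin l)) :
    pc S ((i : ℕ) + 2) = pc S i + (if i ∈ S then 1 else 0) + (if j ∈ S then 1 else 0) := by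
  have := pc_succ S j
  rw [hij, pc_succ] at this
  exact this

theorem colLE_hat_of_not {l : ℕ} (i j : Fin l) (hij : (j : ℕ) = i + 1) (S' S : Finset (Fin l))
    (h : ¬ (j ∈ S' ∧ i ∉ S')) : colLE S' (hat i j S) ↔ colLE S' S := by
  unfold hat
  split_ifs with hS
  · rw [colLE_iff i j hij, colLE_iff i j hij]
    have e : (∀ m, m ≠ (i : ℕ) + 1 → pc (swS i j S) m ≤ pc S' m) ↔
      (∀ m, m ≠ (i : ℕ) + 1 → pc S m ≤ pc S' m) :=
      forall_congr' fun m => forall_congr' fun hm => by rw [pc_swS i j hij S m hm]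
    rw [e]
    refine and_congr_right fun hb => ?_
    have h0 := hb i (by omega)
    have h2 := hb (i + 2) (by omega)
    rw [pc_two i j hij, pc_two i j hij] at h2
    rw [pc_swS i j hij S i (by omega)]
    simp only [i_mem_swS]
    by_cases hi : i ∈ S' <;> by_cases hj : j ∈ S' <;> clear hb <;> simp_all <;> omega
  · rfl

theorem colLE_hat_of_II {l : ℕ} (i j : Fin l) (hij : (j : ℕ) = i + 1) (S' S : Finset (Fin l))
    (h : j ∈ S' ∧ i ∉ S') : colLE S' (hat i j S) ↔ colLE (swS i j S') S := by
  have key : ∀ T : Finset (Fin l), (∀ m, m ≠ (i : ℕ) + 1 → pc T m ≤ pc (swS i j S') m) ↔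
      (∀ m, m ≠ (i : ℕ) + 1 → pc T m ≤ pc S' m) := fun T =>
      forall_congr' fun m => forall_congr' fun hm => by rw [pc_swS i j hij S' m hm]
  unfold hat
  split_ifs with hS
  · rw [colLE_iff i j hij, colLE_iff i j hij, key]
    have e : (∀ m, m ≠ (i : ℕ) + 1 → pc (swS i j S) m ≤ pc S' m) ↔
      (∀ m, m ≠ (i : ℕ) + 1 → pc S m ≤ pc S' m) :=
      forall_congr' fun m => forall_congr' fun hm => by rw [pc_swS i j hij S m hm]
    rw [e]
    refine and_congr_right fun hb => ?_
    have h0 := hb i (by omega)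
    have h2 := hb (i + 2) (by omega)
    rw [pc_two i j hij, pc_two i j hij] at h2
    rw [pc_swS i j hij S i (by omega), pc_swS i j hij S' i (by omega)]
    simp only [i_mem_swS]
    simp_all
  · rw [colLE_iff i j hij, colLE_iff i j hij, key]
    refine and_congr_right fun hb => ?_
    have h0 := hb i (by omega)
    have h2 := hb (i + 2) (by omega)
    rw [pc_two i j hij, pc_two i j hij] at h2
    rw [pc_swS i j hij S' i (by omega)]
    simp only [i_mem_swS]
    by_cases hi : i ∈ S <;> by_cases hj : j ∈ S <;> clear hb <;> simp_all <;> omega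

/-- The squarefree monomial of a set. -/
noncomputable def xset {l : ℕ} (S : Finset (Fin l)) : MvPolynomial (Fin l) ℤ := ∏ c ∈ S, X c

theorem rename_xset {l : ℕ} (i j : Fin l) (S : Finset (Fin l)) :
    rename (Equiv.swap i j) (xset S) = xset (swS i j S) := by
  unfold xset swS
  rw [map_prod, Finset.prod_map]
  simp

open Classical in
/-- Generating polynomial of semistandard fillings of the columns to the left of `S`. -/
noncomputable def KP {l : ℕ} : List ℕ → Finset (Fin l) → MvPolynomial (Fin l) ℤ
  | [], _ => 1
  | k :: cs, S => ∑ S' ∈ Finset.univ.filter (fun S' : Finset (Fin l) => S'.card = k),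
      if colLE S' S then xset S' * KP cs S' else 0

theorem xset_swap {l : ℕ} (i j : Fin l) (S : Finset (Fin l)) (hi : i ∈ S) (hj : j ∉ S) :
    xset (swS i j S) * X i = xset S * X j := by
  have h1 : xset S = X i * ∏ c ∈ S.erase i, X c := by
    unfold xset; rw [Finset.mul_prod_erase _ _ hi]
  have h2 : xset (swS i j S) = X j * ∏ c ∈ (swS i j S).erase j, X c := by
    unfold xset; rw [Finset.mul_prod_erase _ _ ((j_mem_swS i j S).2 hi)]
  have h3 : (swS i j S).erase j = S.erase i := by
    ext c
    simp only [Finset.mem_erase, mem_swS]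
    by_cases h1 : c = i
    · subst h1; simp [hj]
    by_cases h2 : c = j
    · subst h2; simp [hj]
    rw [Equiv.swap_apply_of_ne_of_ne h1 h2]
    tauto
  rw [h1, h2, h3]
  ring

theorem KP_hat {l : ℕ} (i j : Fin l) (hij : (j : ℕ) = i + 1) (cs : List ℕ) :
    ∀ S : Finset (Fin l), (X i - X j) * KP cs (hat i j S) =
      X i * KP cs S - X j * rename (Equiv.swap i j) (KP cs S) := by
  classical
  induction cs with
  | nil => intro S; simp [KP]
  | cons k cs ih =>
    intro S
    set Ω := Finset.univ.filter (fun S' : Finset (Fin l) => S'.card = k) with hΩ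
    set W : Finset (Fin l) → MvPolynomial (Fin l) ℤ := fun S' => xset S' * KP cs S' with hW
    have hR : X i * KP (k :: cs) S - X j * rename (Equiv.swap i j) (KP (k :: cs) S) =
        (X i - X j) * (∑ S' ∈ Ω, (if colLE S' S ∧ ¬ (j ∈ S' ∧ i ∉ S') then W S' else 0) +
          ∑ S' ∈ Ω, (if colLE S' S ∧ (i ∈ S' ∧ j ∉ S') then W (swS i j S') else 0)) := by
      simp only [KP]
      rw [map_sum, Finset.mul_sum, Finset.mul_sum, ← Finset.sum_sub_distrib,
        ← Finset.sum_add_distrib, Finset.mul_sum]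
      refine Finset.sum_congr rfl fun S' _ => ?_
      by_cases hle : colLE S' S
      · simp only [hle, if_true, true_and]
        rw [map_mul, rename_xset]
        have h := ih S'
        rw [hW]
        by_cases hi : i ∈ S' <;> by_cases hj : j ∈ S'
        · rw [swS_eq i j S' (by tauto)]
          simp only [hi, hj, hat] at h ⊢
          simp at h ⊢
          linear_combination (-xset S') * h
        · have hx := xset_swap i j S' hi hj
          simp only [hi, hj, hat] at h ⊢
          simp at h ⊢
          linear_combination (-xset (swS i j S')) * h - KP cs S' * hx
        · have hx := xset_swap i j (swS i j S') (by simpa [i_mem_swS]) (by simpa [j_mem_swS])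
          rw [swS_swS] at hx
          simp only [hi, hj, hat] at h ⊢
          simp at h ⊢
          linear_combination (-xset (swS i j S')) * h + KP cs S' * hx
        · rw [swS_eq i j S' (by tauto)]
          simp only [hi, hj, hat] at h ⊢
          simp at h ⊢
          linear_combination (-xset S') * h
      · simp [hle]
    have hsw : ∑ S' ∈ Ω, (if colLE S' S ∧ (i ∈ S' ∧ j ∉ S') then W (swS i j S') else 0) =
        ∑ S' ∈ Ω, (if colLE (swS i j S') S ∧ (j ∈ S' ∧ i ∉ S') then W S' else 0) := by
      refine Finset.sum_bij' (fun S' _ => swS i j S') (fun S' _ => swS i j S') ?_ ?_ ?_ ?_ ?_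
      · intro S' h; simpa [hΩ, swS] using h
      · intro S' h; simpa [hΩ, swS] using h
      · intro S' _; exact swS_swS i j S'
      · intro S' _; exact swS_swS i j S'
      · intro S' _
        simp only [swS_swS, i_mem_swS, j_mem_swS]
    rw [hR, hsw, ← Finset.sum_add_distrib]
    congr 1
    simp only [KP]
    refine Finset.sum_congr rfl fun S' _ => ?_
    by_cases h : j ∈ S' ∧ i ∉ S'
    · rw [colLE_hat_of_II i j hij S' S h]
      simp [h, hW]
    · rw [colLE_hat_of_not i j hij S' S h]
      simp [h, hW]

theorem KP_symm {l : ℕ} (i j : Fin l) (hij : (j : ℕ) = i + 1) (cs : List ℕ)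
    (S : Finset (Fin l)) (h : ¬ (i ∈ S ∧ j ∉ S)) :
    rename (Equiv.swap i j) (KP cs S) = KP cs S := by
  have := KP_hat i j hij cs S
  rw [hat, if_neg h] at this
  have h2 : (X j : MvPolynomial (Fin l) ℤ) * rename (Equiv.swap i j) (KP cs S) = X j * KP cs S := by
    linear_combination this
  exact mul_left_cancel₀ (X_ne_zero j) h2

end KPoly

section Cone

theorem alt_sum {l : ℕ} {ι : Type*} (s : Finset ι) (F : ι → MvPolynomial (Fin l) ℤ) :
    alt (∑ x ∈ s, F x) = ∑ x ∈ s, alt (F x) := by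
  unfold alt
  rw [Finset.sum_comm]
  refine Finset.sum_congr rfl fun w _ => ?_
  rw [map_sum, Finset.smul_sum]

theorem alt_zero {l : ℕ} : alt (0 : MvPolynomial (Fin l) ℤ) = 0 := by simp [alt]

theorem alt_rename {l : ℕ} (s : Equiv.Perm (Fin l)) (P : MvPolynomial (Fin l) ℤ) :
    alt (rename s P) = (Equiv.Perm.sign s : ℤ) • alt P := by
  unfold alt
  rw [Finset.smul_sum]
  refine Fintype.sum_equiv (Equiv.mulRight s) _ _ fun w => ?_
  rw [rename_rename, Equiv.coe_mulRight, smul_smul, Equiv.Perm.sign_mul]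
  congr 1
  push_cast
  rw [mul_comm, mul_assoc, ← Units.val_mul, Int.units_mul_self]
  simp

theorem alt_eq_zero {l : ℕ} (i j : Fin l) (hij : i ≠ j) (P : MvPolynomial (Fin l) ℤ)
    (h : rename (Equiv.swap i j) P = P) : alt P = 0 := by
  have := alt_rename (Equiv.swap i j) P
  rw [h, Equiv.Perm.sign_swap hij] at this
  simp only [Units.val_neg, Units.val_one, neg_smul, one_smul] at this
  exact self_eq_neg.mp this

theorem alt_mul {l : ℕ} (P K : MvPolynomial (Fin l) ℤ) (hK : K.IsSymmetric) :
    alt (P * K) = alt P * K := by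
  unfold alt
  rw [Finset.sum_mul]
  refine Finset.sum_congr rfl fun w _ => ?_
  rw [map_mul, hK w, smul_mul_assoc]

theorem symm_of_adj {l : ℕ} (P : MvPolynomial (Fin l) ℤ)
    (h : ∀ i j : Fin l, (j : ℕ) = i + 1 → rename (Equiv.swap i j) P = P) : P.IsSymmetric := by
  intro w
  cases l with
  | zero =>
    have : w = 1 := Subsingleton.elim _ _
    subst this
    simp
  | succ n =>
    have hw : w ∈ Submonoid.closure
        (Set.range fun i : Fin n => Equiv.swap i.castSucc i.succ) := by
      rw [Equiv.Perm.mclosure_swap_castSucc_succ]; trivial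
    induction hw using Submonoid.closure_induction with
    | mem x hx =>
      obtain ⟨i, rfl⟩ := hx
      exact h _ _ (by simp)
    | one => simp
    | mul x y _ _ hx hy =>
      rw [Equiv.Perm.coe_mul, ← rename_rename, hy, hx]

theorem KP_empty_symm {l : ℕ} (cs : List ℕ) : (KP cs (∅ : Finset (Fin l))).IsSymmetric :=
  symm_of_adj _ fun i j hij => KP_symm i j hij cs ∅ (by simp)

/-- Indicator. -/
def ind {l : ℕ} (S : Finset (Fin l)) : Fin l → ℕ := fun c => if c ∈ S then 1 else 0

theorem xpow_mul_xset {l : ℕ} (γ : Fin l → ℕ) (S : Finset (Fin l)) :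
    xpow γ * xset S = xpow (γ + ind S) := by
  unfold xpow xset
  simp only [Pi.add_apply, pow_add, Finset.prod_mul_distrib]
  congr 1
  simp [ind, pow_ite, Finset.prod_ite_mem]

theorem xpow_eq_monomial {l : ℕ} (γ : Fin l → ℕ) :
    xpow γ = monomial (Finsupp.equivFunOnFinite.symm γ) 1 := by
  rw [monomial_eq, xpow, Finsupp.prod_fintype]
  · simp
  · simp

theorem rename_xpow {l : ℕ} (w : Equiv.Perm (Fin l)) (γ : Fin l → ℕ) :
    rename w (xpow γ) = xpow (γ ∘ w.symm) := by
  unfold xpow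
  rw [map_prod]
  refine Fintype.prod_equiv w _ _ fun c => ?_
  simp

theorem perm_eq_one {l : ℕ} (w : Equiv.Perm (Fin l)) (h : StrictMono w) : w = 1 := by
  have := StrictMono.range_inj (f := w) (g := id) h strictMono_id |>.1 (by simp)
  ext c
  simp [this]

theorem coeff_alt {l : ℕ} (γ η : Fin l → ℕ) (hγ : StrictAnti γ) (hη : StrictAnti η) :
    coeff (Finsupp.equivFunOnFinite.symm η) (alt (xpow γ)) = if γ = η then 1 else 0 := by
  unfold alt
  rw [coeff_sum, Finset.sum_eq_single 1]
  · simp [xpow_eq_monomial, coeff_monomial]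
  · intro w _ hw
    rw [rename_xpow, xpow_eq_monomial, coeff_smul, coeff_monomial, if_neg, smul_zero]
    intro h
    have h : γ ∘ w.symm = η := Finsupp.equivFunOnFinite.symm.injective h
    apply hw
    have : w.symm = 1 := by
      apply perm_eq_one
      intro a b hab
      have := hη hab
      rw [← h] at this
      exact hγ.lt_iff_gt.1 this
    rw [← Equiv.symm_symm w, this]
    rfl
  · intro h; exact absurd (Finset.mem_univ _) h

/-- Nonnegative combinations of alternants. -/
noncomputable def cone (l : ℕ) : AddSubmonoid (MvPolynomial (Fin l) ℤ) :=
  AddSubmonoid.closure {P | ∃ γ : Fin l → ℕ, StrictAnti γ ∧ P = alt (xpow γ)}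

theorem cone_coeff {l : ℕ} (P : MvPolynomial (Fin l) ℤ) (hP : P ∈ cone l) (η : Fin l → ℕ)
    (hη : StrictAnti η) : 0 ≤ coeff (Finsupp.equivFunOnFinite.symm η) P := by
  induction hP using AddSubmonoid.closure_induction with
  | mem x hx =>
    obtain ⟨γ, hγ, rfl⟩ := hx
    rw [coeff_alt γ η hγ hη]
    split_ifs <;> simp
  | zero => simp
  | add x y _ _ hx hy => rw [coeff_add]; exact add_nonneg hx hy

theorem alt_mem_cone {l : ℕ} (γ : Fin l → ℕ) (h : StrictAnti γ) : alt (xpow γ) ∈ cone l :=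
  AddSubmonoid.subset_closure ⟨γ, h, rfl⟩

open Classical in
theorem alt_KP_cons {l : ℕ} (γ : Fin l → ℕ) (k : ℕ) (cs : List ℕ) (S : Finset (Fin l)) :
    alt (xpow γ * KP (k :: cs) S) =
      ∑ S' ∈ Finset.univ.filter (fun S' : Finset (Fin l) => S'.card = k),
        if colLE S' S then alt (xpow (γ + ind S') * KP cs S') else 0 := by
  rw [KP, Finset.mul_sum, alt_sum]
  refine Finset.sum_congr rfl fun S' _ => ?_
  split_ifs
  · rw [← mul_assoc, xpow_mul_xset]
  · rw [mul_zero, alt_zero]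

theorem strictAnti_of_adj {l : ℕ} (γ : Fin l → ℕ)
    (h : ∀ i j : Fin l, (j : ℕ) = i + 1 → γ j < γ i) : StrictAnti γ := by
  cases l with
  | zero => intro a; exact a.elim0
  | succ n =>
    rw [Fin.strictAnti_iff_succ_lt]
    intro i
    exact h _ _ (by simp)

theorem alt_not_strict {l : ℕ} (γ : Fin l → ℕ) (hγ : StrictAnti γ) (cs : List ℕ)
    (S : Finset (Fin l)) (h : ¬ StrictAnti (γ + ind S)) :
    alt (xpow (γ + ind S) * KP cs S) = 0 := by
  have : ∃ i j : Fin l, (j : ℕ) = i + 1 ∧ (γ + ind S) i ≤ (γ + ind S) j := by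
    by_contra hc
    push Not at hc
    exact h (strictAnti_of_adj _ hc)
  obtain ⟨i, j, hij, hle⟩ := this
  have hlt : i < j := by rw [Fin.lt_def]; omega
  have h1 := hγ hlt
  simp only [Pi.add_apply, ind] at hle
  have hi : i ∉ S := by intro hi; rw [if_pos hi] at hle; split_ifs at hle <;> omega
  have hj : j ∈ S := by by_contra hj; rw [if_neg hj] at hle; omega
  rw [if_pos hj, if_neg hi] at hle
  apply alt_eq_zero i j hlt.ne
  rw [map_mul, KP_symm i j hij cs S (by tauto), rename_xpow]
  congr 2
  ext c
  rw [Equiv.symm_swap, Function.comp]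
  have he : (γ + ind S) i = (γ + ind S) j := by simp [ind, hi, hj]; omega
  by_cases h1 : c = i
  · rw [h1, Equiv.swap_apply_left, he]
  by_cases h2 : c = j
  · rw [h2, Equiv.swap_apply_right, he]
  rw [Equiv.swap_apply_of_ne_of_ne h1 h2]

theorem alt_KP_mem_cone {l : ℕ} (cs : List ℕ) : ∀ (γ : Fin l → ℕ) (_ : StrictAnti γ)
    (S : Finset (Fin l)), alt (xpow γ * KP cs S) ∈ cone l := by
  induction cs with
  | nil => intro γ hγ S; rw [KP, mul_one]; exact alt_mem_cone γ hγ
  | cons k cs ih =>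
    intro γ hγ S
    rw [alt_KP_cons]
    apply AddSubmonoid.sum_mem
    intro S' _
    split_ifs
    · by_cases h : StrictAnti (γ + ind S')
      · exact ih _ h _
      · rw [alt_not_strict γ hγ cs S' h]; exact zero_mem _
    · exact zero_mem _

/-- Dominant column chains. -/
inductive Chn {l : ℕ} : List ℕ → Finset (Fin l) → (Fin l → ℕ) → (Fin l → ℕ) → Prop
  | nil (S : Finset (Fin l)) (γ : Fin l → ℕ) : Chn [] S γ γ
  | cons (k : ℕ) (cs : List ℕ) (S S' : Finset (Fin l)) (γ η : Fin l → ℕ) (h1 : S'.card = k)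
      (h2 : colLE S' S) (h3 : StrictAnti (γ + ind S')) (h4 : Chn cs S' (γ + ind S') η) :
      Chn (k :: cs) S γ η

theorem alt_KP_chain {l : ℕ} (cs : List ℕ) (S : Finset (Fin l)) (γ η : Fin l → ℕ)
    (hγ : StrictAnti γ) (h : Chn cs S γ η) :
    ∃ P ∈ cone l, alt (xpow γ * KP cs S) = alt (xpow η) + P := by
  classical
  induction h with
  | nil S γ => exact ⟨0, zero_mem _, by simp [KP]⟩
  | cons k cs S S' γ η h1 h2 h3 h4 ih =>
    obtain ⟨P, hP, e⟩ := ih h3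
    rw [alt_KP_cons, ← Finset.add_sum_erase _ _ (a := S') (by simpa using h1), if_pos h2, e]
    refine ⟨_, ?_, add_assoc _ _ _⟩
    refine add_mem hP (AddSubmonoid.sum_mem _ ?_)
    intro T _
    split_ifs
    · by_cases h : StrictAnti (γ + ind T)
      · exact alt_KP_mem_cone _ _ h _
      · rw [alt_not_strict γ hγ cs T h]; exact zero_mem _
    · exact zero_mem _

/-- Initial segment. -/
def iseg (l k : ℕ) : Finset (Fin l) := Finset.univ.filter (fun c : Fin l => (c : ℕ) < k)

theorem mem_iseg {l k : ℕ} (c : Fin l) : c ∈ iseg l k ↔ (c : ℕ) < k := by simp [iseg]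

theorem card_iseg {l k : ℕ} (h : k ≤ l) : (iseg l k).card = k := by
  unfold iseg
  rw [Fin.card_filter_val_lt]
  omega

theorem iseg_subset_of_colLE {l k : ℕ} (S : Finset (Fin l)) (h : colLE S (iseg l k)) :
    iseg l k ⊆ S := by
  have h1 := h k
  unfold pc at h1
  have h2 : S.filter (fun c : Fin l => (c : ℕ) < k) ⊆ iseg l k := by
    intro c hc
    rw [mem_iseg]
    exact (Finset.mem_filter.1 hc).2
  have h3 : (iseg l k).filter (fun c : Fin l => (c : ℕ) < k) = iseg l k := by
    ext c; simp [mem_iseg]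
  rw [h3] at h1
  rw [← Finset.eq_of_subset_of_card_le h2 h1]
  exact Finset.filter_subset _ _

theorem eq_iseg {l k : ℕ} (hk : k ≤ l) (S : Finset (Fin l)) (hS : S.card = k)
    (h : ∀ i j : Fin l, (j : ℕ) = i + 1 → j ∈ S → i ∈ S) : S = iseg l k := by
  have hd : ∀ d : ℕ, ∀ i j : Fin l, (j : ℕ) = i + d → j ∈ S → i ∈ S := by
    intro d
    induction d with
    | zero =>
      intro i j hij hj
      have : i = j := by apply Fin.ext; omega
      rwa [this]
    | succ d ih =>
      intro i j hij hj
      have := j.2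
      exact ih i ⟨i + d, by omega⟩ rfl (h _ j (by simp; omega) hj)
  apply Finset.eq_of_subset_of_card_le
  · intro c hc
    rw [mem_iseg]
    have : iseg l (c + 1) ⊆ S := by
      intro b hb
      rw [mem_iseg] at hb
      exact hd (c - b) b c (by omega) hc
    have := Finset.card_le_card this
    rw [card_iseg (by have := c.2; omega)] at this
    omega
  · rw [card_iseg hk, hS]

theorem alt_KP_iseg {l : ℕ} (cs : List ℕ) : ∀ (γ : Fin l → ℕ) (k0 : ℕ) (_ : StrictAnti γ)
    (_ : cs.Pairwise (· ≤ ·)) (_ : ∀ k ∈ cs, k0 ≤ k ∧ k ≤ l)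
    (_ : ∀ i j : Fin l, (j : ℕ) = i + 1 → k0 ≤ i → γ i = γ j + 1),
    alt (xpow γ * KP cs (iseg l k0)) =
      alt (xpow (γ + fun c => (cs.map (fun k => ind (iseg l k) c)).sum)) := by
  classical
  induction cs with
  | nil =>
    intro γ k0 _ _ _ _
    rw [KP, mul_one]
    congr 2
  | cons k cs ih =>
    intro γ k0 hγ hs hk hst
    obtain ⟨hk0, hkl⟩ := hk k (by simp)
    rw [List.pairwise_cons] at hs
    rw [alt_KP_cons, Finset.sum_eq_single (iseg l k)]
    · rw [if_pos, ih _ k]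
      · congr 2
        ext c
        simp [add_assoc]
      · apply strictAnti_of_adj
        intro i j hij
        have := hγ (show i < j by rw [Fin.lt_def]; omega)
        simp only [Pi.add_apply, ind, mem_iseg]
        split_ifs <;> omega
      · exact hs.2
      · intro k' hk'
        exact ⟨hs.1 k' hk', (hk k' (by simp [hk'])).2⟩
      · intro i j hij hki
        have := hst i j hij (by omega)
        simp only [Pi.add_apply, ind, mem_iseg]
        split_ifs <;> omega
      · intro m
        apply Finset.card_le_card
        intro c
        simp only [Finset.mem_filter, mem_iseg]
        omega
    · intro S hS hne
      rw [Finset.mem_filter] at hS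
      split_ifs with hle
      · apply alt_not_strict γ hγ
        intro hstr
        apply hne
        apply eq_iseg hkl S hS.2
        intro i j hij hj
        by_cases hi : (i : ℕ) < k0
        · exact iseg_subset_of_colLE S hle ((mem_iseg i).2 hi)
        · have h1 := hst i j hij (by omega)
          have h2 := hstr (show i < j by rw [Fin.lt_def]; omega)
          by_contra hn
          simp only [Pi.add_apply, ind, if_pos hj, if_neg hn] at h2
          omega
      · rfl
    · intro h
      simp [card_iseg hkl] at h

end Cone

section Comb

/-- The basic counting function. -/
def gg (b k i m : ℕ) : ℕ := max (m + k - b) (min (min k m) ((m + k + 1 - i) / 2))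

set_option maxHeartbeats 4000000 in
theorem gg_inc (b k p t : ℕ) (hk : k ≤ b) (hp : p + 1 ≤ b) (ht : t < b) :
    gg b k (p + 1) (t + 1) = gg b k (p + 1) t +
      (if t + p < k ∨ 2 * b ≤ t + p + k + 1 then 1 else
        if p + k ≤ t ∨ t + k ≤ p then 0 else (t + p + k) % 2) := by
  unfold gg; split_ifs <;> omega

theorem gg_symm (b k p t : ℕ) (hk : k ≤ b) (hp : p + 1 ≤ b) (ht : t < b) :
    gg b k (p + 1) (t + 1) + gg b k (t + 1) p = gg b k (t + 1) (p + 1) + gg b k (p + 1) t := by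
  have h1 := gg_inc b k p t hk hp ht
  have h2 := gg_inc b k t p hk ht hp
  rw [h1, h2]
  split_ifs <;> omega

theorem gg_step (b k p t : ℕ) (hk : k ≤ b) (hp : p + 1 ≤ b) (ht : t < b) :
    gg b k (p + 1) t ≤ gg b k (p + 1) (t + 1) ∧ gg b k (p + 1) (t + 1) ≤ gg b k (p + 1) t + 1 := by
  unfold gg; omega

theorem gg_zero (b k p : ℕ) (hk : k ≤ b) : gg b k p 0 = 0 := by
  unfold gg; omega

theorem gg_end (b k p : ℕ) (hk : k ≤ b) : gg b k p b = k := by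
  unfold gg; omega

theorem gg_anti (b k p p' t : ℕ) (h : p ≤ p') : gg b k p' t ≤ gg b k p t := by
  unfold gg; omega

theorem gg_le (b k p t : ℕ) (hk : k ≤ b) : gg b k p t ≤ t := by
  unfold gg; omega

theorem gg_last (b k p : ℕ) (hk : k ≤ b) (hp : p + 1 ≤ b) :
    gg b k b (p + 1) = gg b k b p + (if b < p + 1 + k then 1 else 0) := by
  unfold gg; split_ifs <;> omega

/-- Abstract block data: `s c` is the start and `b c` the size of the block of `c`. -/
structure Blk (l : ℕ) (s b : Fin l → ℕ) : Prop where
  lo : ∀ c : Fin l, s c ≤ (c : ℕ)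
  hi : ∀ c : Fin l, (c : ℕ) < s c + b c
  le : ∀ c : Fin l, s c + b c ≤ l
  same : ∀ c d : Fin l, s c ≤ (d : ℕ) → (d : ℕ) < s c + b c → s d = s c ∧ b d = b c

/-- Number of times `c` is used before time `N` for column length `k`. -/
def UU {l : ℕ} (s b : Fin l → ℕ) (N k : ℕ) (c : Fin l) : ℕ :=
  (N / b c) * min (k - s c) (b c) + gg (b c) (min (k - s c) (b c)) (c - s c + 1) (N % b c)

/-- The column used at time `N` for column length `k`. -/
def SS {l : ℕ} (s b : Fin l → ℕ) (N k : ℕ) : Finset (Fin l) :=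
  Finset.univ.filter (fun c => UU s b (N + 1) k c = UU s b N k c + 1)

theorem UU_zero {l : ℕ} {s b : Fin l → ℕ} (k : ℕ) (c : Fin l) : UU s b 0 k c = 0 := by
  unfold UU
  rw [Nat.zero_div, Nat.zero_mod, gg_zero _ _ _ (Nat.min_le_right _ _)]
  simp

theorem UU_step {l : ℕ} {s b : Fin l → ℕ} (H : Blk l s b) (N k : ℕ) (c : Fin l) :
    UU s b (N + 1) k c + gg (b c) (min (k - s c) (b c)) (c - s c + 1) (N % b c) =
      UU s b N k c + gg (b c) (min (k - s c) (b c)) (c - s c + 1) (N % b c + 1) := by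
  have h1 := H.lo c
  have h2 := H.hi c
  have hb : 0 < b c := by omega
  have hm := Nat.mod_lt N hb
  unfold UU
  by_cases h : N % b c + 1 < b c
  · have e1 : (N + 1) / b c = N / b c := by
      rw [Nat.succ_div_of_not_dvd]
      intro hd
      have := Nat.mod_eq_zero_of_dvd hd
      rw [Nat.add_mod, Nat.mod_eq_of_lt (a := 1) (by omega), Nat.mod_eq_of_lt h] at this
      omega
    have e2 : (N + 1) % b c = N % b c + 1 := by
      rw [Nat.add_mod, Nat.mod_eq_of_lt (a := 1) (by omega), Nat.mod_eq_of_lt h]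
    rw [e1, e2]
    omega
  · have e0 : N % b c + 1 = b c := by omega
    have hd : b c ∣ N + 1 := by
      refine ⟨N / b c + 1, ?_⟩
      have := Nat.div_add_mod N (b c)
      rw [mul_add]
      omega
    have e2 : (N + 1) % b c = 0 := Nat.mod_eq_zero_of_dvd hd
    rw [Nat.succ_div_of_dvd hd, e2, e0, gg_zero _ _ _ (Nat.min_le_right _ _),
      gg_end _ _ _ (Nat.min_le_right _ _)]
    ring

theorem UU_ind {l : ℕ} {s b : Fin l → ℕ} (H : Blk l s b) (N k : ℕ) (c : Fin l) :
    UU s b (N + 1) k c = UU s b N k c + ind (SS s b N k) c := by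
  have h1 := H.lo c
  have h2 := H.hi c
  have hb : 0 < b c := by omega
  have hm := Nat.mod_lt N hb
  have := UU_step H N k c
  have h3 := gg_step (b c) (min (k - s c) (b c)) (c - s c) (N % b c) (Nat.min_le_right _ _)
    (by omega) hm
  simp only [ind, SS, Finset.mem_filter, Finset.mem_univ, true_and]
  split_ifs <;> omega

theorem ind_SS {l : ℕ} {s b : Fin l → ℕ} (H : Blk l s b) (N k : ℕ) (c : Fin l) :
    gg (b c) (min (k - s c) (b c)) (N % b c + 1) (c - s c + 1) =
      gg (b c) (min (k - s c) (b c)) (N % b c + 1) (c - s c) + ind (SS s b N k) c := by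
  have h1 := H.lo c
  have h2 := H.hi c
  have hb : 0 < b c := by omega
  have hm := Nat.mod_lt N hb
  have h0 := UU_step H N k c
  have h4 := UU_ind H N k c
  have h3 := gg_symm (b c) (min (k - s c) (b c)) (c - s c) (N % b c) (Nat.min_le_right _ _)
    (by omega) hm
  omega

theorem UU_le {l : ℕ} {s b : Fin l → ℕ} (N k : ℕ) (c : Fin l) : UU s b N k c ≤ N := by
  unfold UU
  have h1 := gg_le (b c) (min (k - s c) (b c)) (c - s c + 1) (N % b c) (Nat.min_le_right _ _)
  have h2 : (N / b c) * min (k - s c) (b c) ≤ (N / b c) * b c :=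
    Nat.mul_le_mul_left _ (Nat.min_le_right _ _)
  have h3 := Nat.div_add_mod N (b c)
  rw [mul_comm] at h3
  omega

theorem UU_anti {l : ℕ} {s b : Fin l → ℕ} (H : Blk l s b) (N k : ℕ) : Antitone (UU s b N k) := by
  intro c d hcd
  have hcd : (c : ℕ) ≤ d := hcd
  by_cases h : (d : ℕ) < s c + b c
  · obtain ⟨e1, e2⟩ := H.same c d ((H.lo c).trans hcd) h
    unfold UU
    rw [e1, e2]
    have := gg_anti (b c) (min (k - s c) (b c)) (c - s c + 1) (d - s c + 1) (N % b c) (by omega)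
    omega
  · have hsd : s c + b c ≤ s d := by
      by_contra hn
      have hc := H.lo c
      have hh := H.hi c
      by_cases h3 : s d ≤ c
      · have := H.same d c h3 (by have := H.hi d; omega)
        have := H.hi d
        omega
      · have hl := H.le c
        have hlo := H.lo d
        have hhi := H.hi d
        obtain ⟨e1, e2⟩ := H.same c ⟨s d, by omega⟩ (by simp; omega) (by simp; omega)
        obtain ⟨e3, e4⟩ := H.same d ⟨s d, by omega⟩ (by simp) (by simp; omega)
        omega
    by_cases hk : k ≤ s d
    · have : UU s b N k d = 0 := by
        unfold UU
        have e : min (k - s d) (b d) = 0 := by omega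
        rw [e]
        have hb : 0 < b d := by have := H.lo d; have := H.hi d; omega
        have := Nat.mod_lt N hb
        unfold gg
        omega
      omega
    · have : UU s b N k c = N := by
        unfold UU
        have e : min (k - s c) (b c) = b c := by omega
        rw [e]
        have h3 := Nat.div_add_mod N (b c)
        rw [mul_comm] at h3
        have hb : 0 < b c := by have := H.lo c; have := H.hi c; omega
        have := Nat.mod_lt N hb
        have h4 : gg (b c) (b c) (c - s c + 1) (N % b c) = N % b c := by unfold gg; omega
        omega
      have := UU_le (s := s) (b := b) N k d
      omega

theorem pc_SS {l : ℕ} {s b : Fin l → ℕ} (H : Blk l s b) (N k : ℕ) : ∀ (m : ℕ) (hm : m < l),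
    pc (SS s b N k) (m + 1) = min k (s ⟨m, hm⟩) +
      gg (b ⟨m, hm⟩) (min (k - s ⟨m, hm⟩) (b ⟨m, hm⟩)) (N % b ⟨m, hm⟩ + 1)
        (m - s ⟨m, hm⟩ + 1) := by
  intro m
  induction m with
  | zero =>
    intro hm
    have h1 := pc_succ (SS s b N k) ⟨0, hm⟩
    have h2 := ind_SS H N k ⟨0, hm⟩
    have h3 := H.lo ⟨0, hm⟩
    have h4 : pc (SS s b N k) 0 = 0 := by simp [pc]
    simp only [ind] at h1 h2 h3 ⊢
    have h5 : s ⟨0, hm⟩ = 0 := by omega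
    simp only [h5, Nat.zero_sub] at h2 ⊢
    rw [gg_zero _ _ _ (Nat.min_le_right _ _)] at h2
    omega
  | succ m ih =>
    intro hm
    have h1 := pc_succ (SS s b N k) ⟨m + 1, hm⟩
    have h2 := ind_SS H N k ⟨m + 1, hm⟩
    have h0 := ih (by omega)
    have h3 := H.lo ⟨m + 1, hm⟩
    have h6 := H.lo ⟨m, by omega⟩
    have h7 := H.hi ⟨m, by omega⟩
    simp only [ind] at h1 h2 h3 h6 h7 ⊢
    by_cases hs : m + 1 < s ⟨m, by omega⟩ + b ⟨m, by omega⟩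
    · obtain ⟨e1, e2⟩ := H.same ⟨m, by omega⟩ ⟨m + 1, hm⟩ (by simp; omega) (by simpa using hs)
      rw [e1, e2] at h2 ⊢
      have e3 : m + 1 - s ⟨m, by omega⟩ = m - s ⟨m, by omega⟩ + 1 := by omega
      rw [e3] at h2 ⊢
      omega
    · have e0 : s ⟨m + 1, hm⟩ = m + 1 := by
        by_contra hne
        obtain ⟨e1, e2⟩ := H.same ⟨m + 1, hm⟩ ⟨m, by omega⟩ (by simp; omega)
          (by have := H.hi ⟨m + 1, hm⟩; simp at this ⊢; omega)
        have := H.hi ⟨m + 1, hm⟩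
        simp at this
        omega
      have e4 : m - s ⟨m, by omega⟩ + 1 = b ⟨m, by omega⟩ := by omega
      rw [e4, gg_end _ _ _ (Nat.min_le_right _ _)] at h0
      rw [e0, Nat.sub_self] at h2 ⊢
      rw [gg_zero _ _ _ (Nat.min_le_right _ _)] at h2
      omega

theorem pc_top {l : ℕ} (S : Finset (Fin l)) (m : ℕ) (hm : l ≤ m) : pc S m = S.card := by
  unfold pc
  rw [Finset.filter_true_of_mem]
  intro c _
  have := c.2
  omega

theorem card_SS {l : ℕ} {s b : Fin l → ℕ} (H : Blk l s b) (N k : ℕ) (hk : k ≤ l) :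
    (SS s b N k).card = k := by
  rw [← pc_top _ l le_rfl]
  cases l with
  | zero => simp [pc]; omega
  | succ n =>
    rw [pc_SS H N k n (by omega)]
    have h1 := H.lo ⟨n, by omega⟩
    have h2 := H.hi ⟨n, by omega⟩
    have h3 := H.le ⟨n, by omega⟩
    simp only at h1 h2 h3
    have e : n - s ⟨n, by omega⟩ + 1 = b ⟨n, by omega⟩ := by omega
    rw [e, gg_end _ _ _ (Nat.min_le_right _ _)]
    omega

theorem gg_mono (b k k' i p : ℕ) (hk : k ≤ k') : gg b k i p ≤ gg b k' i p := by
  unfold gg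
  have h1 : (p + k + 1 - i) / 2 ≤ (p + k' + 1 - i) / 2 := Nat.div_le_div_right (by omega)
  exact max_le_max (by omega) (min_le_min (min_le_min hk le_rfl) h1)

theorem gg_mono_aux (s b k k' i p : ℕ) (hk : k ≤ k') (hp : p ≤ b) (hi : i ≤ b) :
    min k s + gg b (min (k - s) b) i p ≤ min k' s + gg b (min (k' - s) b) i p := by
  have h1 : gg b (min (k - s) b) i p ≤ gg b (min (k' - s) b) i p :=
    gg_mono b _ _ i p (by omega)
  omega

theorem colLE_SS {l : ℕ} {s b : Fin l → ℕ} (H : Blk l s b) (N k k' : ℕ) (hk : k ≤ k')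
    (hk' : k' ≤ l) : colLE (SS s b N k') (SS s b N k) := by
  intro m
  by_cases hm : l ≤ m
  · rw [pc_top _ _ hm, pc_top _ _ hm, card_SS H N k (by omega), card_SS H N k' hk']
    exact hk
  cases m with
  | zero => simp [pc]
  | succ m =>
    rw [pc_SS H N k m (by omega), pc_SS H N k' m (by omega)]
    have h1 := H.lo ⟨m, by omega⟩
    have h2 := H.hi ⟨m, by omega⟩
    simp only at h1 h2
    have hb : 0 < b ⟨m, by omega⟩ := by omega
    have hm := Nat.mod_lt N hb
    exact gg_mono_aux _ _ _ _ _ _ hk (by omega) (by omega)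

theorem chain_SS {l : ℕ} {s b : Fin l → ℕ} (H : Blk l s b) (N : ℕ) (cs : List ℕ) :
    ∀ (S : Finset (Fin l)) (B : Fin l → ℕ) (_ : Antitone B) (_ : cs.Pairwise (· ≤ ·))
      (_ : ∀ k ∈ cs, k ≤ l) (_ : ∀ k ∈ cs, colLE (SS s b N k) S),
    Chn cs S (fun c => stair l c + B c + (cs.map (fun k => UU s b N k c)).sum)
      (fun c => stair l c + B c + (cs.map (fun k => UU s b (N + 1) k c)).sum) := by
  induction cs with
  | nil => intro S B _ _ _ _; exact Chn.nil _ _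
  | cons k cs ih =>
    intro S B hB hs hl hle
    rw [List.pairwise_cons] at hs
    have hB' : Antitone (fun c => B c + UU s b (N + 1) k c) := by
      intro c d hcd
      exact add_le_add (hB hcd) (UU_anti H _ _ hcd)
    have e1 : (fun c => stair l c + B c + ((k :: cs).map (fun k => UU s b N k c)).sum) +
        ind (SS s b N k) = fun c => stair l c + (B c + UU s b (N + 1) k c) +
          (cs.map (fun k => UU s b N k c)).sum := by
      ext c
      rw [UU_ind H]
      simp only [Pi.add_apply, List.map_cons, List.sum_cons]
      ring
    have e2 : (fun c => stair l c + B c + ((k :: cs).map (fun k => UU s b (N + 1) k c)).sum) =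
        fun c => stair l c + (B c + UU s b (N + 1) k c) +
          (cs.map (fun k => UU s b (N + 1) k c)).sum := by
      ext c
      simp only [List.map_cons, List.sum_cons]
      ring
    refine Chn.cons k cs S (SS s b N k) _ _ (card_SS H N k (hl k (by simp)))
      (hle k (by simp)) ?_ ?_
    · rw [e1]
      intro c d hcd
      have h1 := hB' hcd.le
      have h2 : (cs.map (fun k => UU s b N k d)).sum ≤ (cs.map (fun k => UU s b N k c)).sum :=
        List.sum_le_sum fun k _ => UU_anti H N k hcd.le
      have h3 : stair l d < stair l c := by
        have := d.2
        have : (c : ℕ) < d := hcd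
        unfold stair
        omega
      simp only at h1 ⊢
      omega
    · rw [e1, e2]
      refine ih _ _ hB' hs.2 (fun k' hk' => hl k' (by simp [hk'])) fun k' hk' => ?_
      exact colLE_SS H N k k' (hs.1 k' hk') (hl k' (by simp [hk']))

end Comb

section Final

theorem filter_eq_iseg {l : ℕ} (p : Fin l → Prop) [DecidablePred p]
    (h : ∀ i j : Fin l, i ≤ j → p j → p i) (c : Fin l) :
    p c ↔ (c : ℕ) < (Finset.univ.filter p).card := by
  have e : Finset.univ.filter p = iseg l (Finset.univ.filter p).card := by
    refine eq_iseg ?_ _ rfl ?_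
    · simpa using Finset.card_le_univ (Finset.univ.filter p)
    · intro i j hij hj
      simp only [Finset.mem_filter, Finset.mem_univ, true_and] at hj ⊢
      exact h i j (by rw [Fin.le_def]; omega) hj
  rw [← mem_iseg, ← e]
  simp

theorem lt_bstart {l ι : ℕ} {f : Fin l → Fin ι} (hf : Monotone f) (q : Fin ι) (c : Fin l) :
    f c < q ↔ (c : ℕ) < bstart l ι f q :=
  filter_eq_iseg (fun i => f i < q) (fun _ _ hij hj => (hf hij).trans_lt hj) c

theorem lt_bend {l ι : ℕ} {f : Fin l → Fin ι} (hf : Monotone f) (q : Fin ι) (c : Fin l) :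
    f c ≤ q ↔ (c : ℕ) < bend l ι f q :=
  filter_eq_iseg (fun i => f i ≤ q) (fun _ _ hij hj => (hf hij).trans hj) c

theorem bend_eq {l ι : ℕ} (f : Fin l → Fin ι) (q : Fin ι) :
    bend l ι f q = bstart l ι f q + bsize l ι f q := by
  unfold bend bstart bsize
  rw [← Finset.card_union_of_disjoint]
  · congr 1
    ext c
    simp [le_iff_lt_or_eq]
  · rw [Finset.disjoint_filter]
    intro c _ h1 h2
    exact h1.ne h2

theorem bend_le {l ι : ℕ} (f : Fin l → Fin ι) (q : Fin ι) : bend l ι f q ≤ l := by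
  unfold bend
  simpa using Finset.card_le_univ (Finset.univ.filter fun i => f i ≤ q)

theorem blk_f {l ι : ℕ} {f : Fin l → Fin ι} (hf : Monotone f) :
    Blk l (fun c => bstart l ι f (f c)) (fun c => bsize l ι f (f c)) where
  lo c := by
    by_contra h
    exact lt_irrefl _ ((lt_bstart hf (f c) c).2 (by simpa using h))
  hi c := by
    have := (lt_bend hf (f c) c).1 le_rfl
    rw [bend_eq] at this
    exact this
  le c := by
    have := bend_le f (f c)
    rw [bend_eq] at this
    exact this
  same c d h1 h2 := by
    have e : f d = f c := by
      refine le_antisymm ?_ ?_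
      · rw [lt_bend hf, bend_eq]; exact h2
      · by_contra h
        have := (lt_bstart hf (f c) d).1 (not_le.1 h)
        omega
    simp only [e, and_self]

theorem bsize_dvd {l ι : ℕ} {f : Fin l → Fin ι} (hf : Monotone f) (c : Fin l) :
    bsize l ι f (f c) ∣ Lnum l := by
  have h1 := (blk_f hf).lo c
  have h2 := (blk_f hf).hi c
  have h3 := (blk_f hf).le c
  have h4 : bsize l ι f (f c) ∈ Finset.Icc 1 l := by
    rw [Finset.mem_Icc]
    constructor <;> omega
  exact Finset.dvd_lcm (f := id) h4

theorem Lnum_pos (l : ℕ) : 0 < Lnum l := by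
  rw [Nat.pos_iff_ne_zero]
  unfold Lnum
  rw [Ne, Finset.lcm_eq_zero_iff]
  simp

/-- Column lengths. -/
def colLen {l : ℕ} (A : Fin l → ℕ) (j : ℕ) : ℕ := (Finset.univ.filter fun c => j < A c).card

theorem lt_colLen {l : ℕ} {A : Fin l → ℕ} (hA : Antitone A) (j : ℕ) (c : Fin l) :
    j < A c ↔ (c : ℕ) < colLen A j :=
  filter_eq_iseg (fun c => j < A c) (fun _ _ hij hj => hj.trans_le (hA hij)) c

theorem colLen_le {l : ℕ} (A : Fin l → ℕ) (j : ℕ) : colLen A j ≤ l := by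
  unfold colLen
  simpa using Finset.card_le_univ (Finset.univ.filter fun c => j < A c)

theorem colLen_anti {l : ℕ} (A : Fin l → ℕ) : Antitone (colLen A) := by
  intro j j' h
  unfold colLen
  apply Finset.card_le_card
  intro c
  simp only [Finset.mem_filter, Finset.mem_univ, true_and]
  omega

/-- Number of columns. -/
def ncol {l : ℕ} (A : Fin l → ℕ) : ℕ := ∑ c, A c

theorem le_ncol {l : ℕ} (A : Fin l → ℕ) (c : Fin l) : A c ≤ ncol A :=
  Finset.single_le_sum (f := A) (fun _ _ => Nat.zero_le _) (Finset.mem_univ c)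

/-- Columns, in increasing order. -/
def cols {l : ℕ} (A : Fin l → ℕ) : List ℕ := ((List.range (ncol A)).reverse).map (colLen A)

theorem cols_sum {l : ℕ} (A : Fin l → ℕ) (F : ℕ → ℕ) :
    ((cols A).map F).sum = ∑ j ∈ Finset.range (ncol A), F (colLen A j) := by
  unfold cols
  rw [List.map_map, List.map_reverse, List.sum_reverse]
  rfl

theorem cols_le {l : ℕ} (A : Fin l → ℕ) : ∀ k ∈ cols A, k ≤ l := by
  intro k hk
  unfold cols at hk
  rw [List.mem_map] at hk
  obtain ⟨j, _, rfl⟩ := hk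
  exact colLen_le A j

theorem cols_pairwise {l : ℕ} (A : Fin l → ℕ) : (cols A).Pairwise (· ≤ ·) := by
  unfold cols
  rw [List.pairwise_map, List.pairwise_reverse]
  exact List.pairwise_lt_range.imp fun h => colLen_anti A h.le

theorem sum_lt (M a : ℕ) (h : a ≤ M) : ∑ j ∈ Finset.range M, (if j < a then 1 else 0) = a := by
  rw [← Finset.card_filter]
  have : (Finset.range M).filter (fun j => j < a) = Finset.range a := by
    ext j; simp; omega
  rw [this, Finset.card_range]

theorem sum_col {l : ℕ} {A : Fin l → ℕ} (hA : Antitone A) (c : Fin l) :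
    ∑ j ∈ Finset.range (ncol A), (if (c : ℕ) < colLen A j then 1 else 0) = A c := by
  simp only [← lt_colLen hA]
  exact sum_lt _ _ (le_ncol A c)

theorem stair_strict (l : ℕ) : StrictAnti (stair l) := by
  intro c d h
  have := d.2
  have : (c : ℕ) < d := h
  unfold stair
  omega

theorem vdm_ne_zero (l : ℕ) : vdm l ≠ 0 := by
  intro h
  have := coeff_alt (stair l) (stair l) (stair_strict l) (stair_strict l)
  rw [← vdm_eq_alt, h] at this
  simp at this

theorem schur_eq_KP {l : ℕ} {A : Fin l → ℕ} (hA : Antitone A) : schur l A = KP (cols A) ∅ := by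
  apply mul_right_cancel₀ (vdm_ne_zero l)
  rw [schur_mul_vdm]
  have h0 : iseg l 0 = ∅ := by simp [iseg]
  have := alt_KP_iseg (cols A) (stair l) 0 (stair_strict l) (cols_pairwise A)
    (fun k hk => ⟨Nat.zero_le _, cols_le A k hk⟩)
    (by intro i j hij _; have := j.2; unfold stair; omega)
  rw [h0, alt_mul _ _ (KP_empty_symm _), ← vdm_eq_alt, mul_comm] at this
  rw [this]
  congr 2
  ext c
  simp only [Pi.add_apply, cols_sum]
  simp only [ind, mem_iseg, sum_col hA]
  rw [add_comm]

theorem cone_mul {l : ℕ} (cs : List ℕ) (P : MvPolynomial (Fin l) ℤ) (hP : P ∈ cone l) :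
    P * KP cs ∅ ∈ cone l := by
  induction hP using AddSubmonoid.closure_induction with
  | mem x hx =>
    obtain ⟨γ, hγ, rfl⟩ := hx
    rw [← alt_mul _ _ (KP_empty_symm _)]
    exact alt_KP_mem_cone cs γ hγ ∅
  | zero => simp
  | add x y _ _ hx hy => rw [add_mul]; exact add_mem hx hy

/-- Exponent at time `N`. -/
def gam {l : ℕ} (s b : Fin l → ℕ) (A : Fin l → ℕ) (N : ℕ) (c : Fin l) : ℕ :=
  ∑ j ∈ Finset.range (ncol A), UU s b N (colLen A j) c

theorem gam_anti {l : ℕ} {s b : Fin l → ℕ} (H : Blk l s b) (A : Fin l → ℕ) (N : ℕ) :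
    Antitone (gam s b A N) := by
  intro c d h
  exact Finset.sum_le_sum fun j _ => UU_anti H N _ h

theorem gam_strict {l : ℕ} {s b : Fin l → ℕ} (H : Blk l s b) (A : Fin l → ℕ) (N : ℕ) :
    StrictAnti (fun c => stair l c + gam s b A N c) := by
  intro c d h
  exact add_lt_add_of_lt_of_le (stair_strict l h) (gam_anti H A N h.le)

theorem pow_cone {l : ℕ} {s b : Fin l → ℕ} (H : Blk l s b) (A : Fin l → ℕ) (N : ℕ) :
    ∃ P ∈ cone l, KP (cols A) ∅ ^ N * vdm l =
      alt (xpow (fun c => stair l c + gam s b A N c)) + P := by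
  induction N with
  | zero =>
    refine ⟨0, zero_mem _, ?_⟩
    have : (fun c => stair l c + gam s b A 0 c) = stair l := by
      ext c
      simp [gam, UU_zero]
    rw [this, ← vdm_eq_alt]
    simp
  | succ N ih =>
    obtain ⟨P, hP, e⟩ := ih
    have hc := chain_SS H N (cols A) ∅ (fun _ => 0) (fun _ _ _ => le_rfl) (cols_pairwise A)
      (cols_le A) (fun k _ m => by simp [pc])
    simp only [cols_sum, add_zero] at hc
    obtain ⟨Q, hQ, e2⟩ := alt_KP_chain _ _ _ _ (gam_strict H A N) hc
    refine ⟨Q + P * KP (cols A) ∅, add_mem hQ (cone_mul _ _ hP), ?_⟩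
    rw [alt_mul _ _ (KP_empty_symm _)] at e2
    calc _ = (KP (cols A) ∅ ^ N * vdm l) * KP (cols A) ∅ := by ring
      _ = _ := by rw [e, add_mul, e2, add_assoc]; rfl

theorem mult_pos {l : ℕ} {s b : Fin l → ℕ} (H : Blk l s b) {A : Fin l → ℕ} (hA : Antitone A)
    (N : ℕ) : 0 < schurMult l (gam s b A N) (schur l A ^ N) := by
  obtain ⟨P, hP, e⟩ := pow_cone H A N
  unfold schurMult
  rw [schur_eq_KP hA, e]
  have e3 : (fun i : Fin l => gam s b A N i + (l - 1 - (i : ℕ))) =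
      fun c => stair l c + gam s b A N c := by
    ext c
    rw [add_comm]
    rfl
  rw [e3, coeff_add, coeff_alt _ _ (gam_strict H A N) (gam_strict H A N), if_pos rfl]
  have := cone_coeff P hP _ (gam_strict H A N)
  omega

theorem gam_GJ {l ι : ℕ} {f : Fin l → Fin ι} (hf : Monotone f) {A : Fin l → ℕ} (hA : Antitone A)
    (c : Fin l) : gam (fun c => bstart l ι f (f c)) (fun c => bsize l ι f (f c)) A (Lnum l) c =
      GJ l ι f A c := by
  have hd := bsize_dvd hf c
  unfold gam GJ UU
  simp only [Nat.mod_eq_zero_of_dvd hd, gg_zero _ _ _ (Nat.min_le_right _ _), add_zero]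
  rw [← Finset.mul_sum]
  congr 1
  unfold bsum
  rw [Finset.sum_congr rfl fun r _ => (sum_col hA r).symm, Finset.sum_comm]
  refine Finset.sum_congr rfl fun j _ => ?_
  rw [← Finset.card_filter, Finset.filter_filter]
  have h1 : (Finset.univ.filter fun r : Fin l => f r = f c ∧ (r : ℕ) < colLen A j) =
      iseg l (min (colLen A j) (bend l ι f (f c))) \ iseg l (bstart l ι f (f c)) := by
    ext r
    simp only [Finset.mem_filter, Finset.mem_univ, true_and, Finset.mem_sdiff, mem_iseg, lt_min_iff,
      ← lt_bend hf, ← lt_bstart hf]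
    constructor
    · rintro ⟨h1, h2⟩
      exact ⟨⟨h2, h1.le⟩, by simp [h1]⟩
    · rintro ⟨⟨h1, h2⟩, h3⟩
      exact ⟨le_antisymm h2 (not_lt.1 h3), h1⟩
  have hbe := bend_eq f (f c)
  have hbl := bend_le f (f c)
  have h2 : iseg l (min (colLen A j) (bend l ι f (f c))) \ iseg l (bstart l ι f (f c)) =
      iseg l (max (min (colLen A j) (bend l ι f (f c))) (bstart l ι f (f c))) \
        iseg l (bstart l ι f (f c)) := by
    ext r
    simp only [Finset.mem_sdiff, mem_iseg]
    omega
  rw [h1, h2, Finset.card_sdiff_of_subset, card_iseg, card_iseg]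
  · omega
  · omega
  · have := colLen_le A j
    omega
  · intro r
    simp only [mem_iseg]
    omega

theorem gam_chi {l ι : ℕ} {f : Fin l → Fin ι} (hf : Monotone f) {A : Fin l → ℕ} (hA : Antitone A)
    (c : Fin l) : (GJ l ι f A c : ℤ) + chiJ l ι f A c =
      gam (fun c => bstart l ι f (f c)) (fun c => bsize l ι f (f c)) A (Lnum l - 1) c := by
  have hL := Lnum_pos l
  have H := blk_f hf
  have hlo := H.lo c
  have hhi := H.hi c
  have hle := H.le c
  have hd := bsize_dvd hf c
  have hbe := bend_eq f (f c)
  have hr : reflIdx l ι f c < l := by unfold reflIdx; omega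
  have key : GJ l ι f A c = gam (fun c => bstart l ι f (f c)) (fun c => bsize l ι f (f c)) A
      (Lnum l - 1) c + A ⟨reflIdx l ι f c, hr⟩ := by
    rw [← gam_GJ hf hA]
    obtain ⟨N, hN⟩ : ∃ N, Lnum l = N + 1 := ⟨Lnum l - 1, by omega⟩
    have hmod : N % bsize l ι f (f c) + 1 = bsize l ι f (f c) := by
      obtain ⟨q, hq⟩ := hd
      have hb : 0 < bsize l ι f (f c) := by omega
      have hq0 : q ≠ 0 := by rintro rfl; omega
      obtain ⟨q, rfl⟩ := Nat.exists_eq_succ_of_ne_zero hq0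
      have : N = (bsize l ι f (f c) - 1) + bsize l ι f (f c) * q := by
        rw [Nat.succ_eq_add_one, mul_add] at hq
        omega
      rw [this, Nat.add_mul_mod_self_left, Nat.mod_eq_of_lt (by omega)]
      omega
    rw [hN, Nat.add_sub_cancel]
    unfold gam
    rw [← sum_col hA ⟨reflIdx l ι f c, hr⟩, ← Finset.sum_add_distrib]
    refine Finset.sum_congr rfl fun j _ => ?_
    rw [UU_ind H]
    congr 1
    have h1 := ind_SS H N (colLen A j) c
    simp only [hmod] at h1
    rw [gg_last _ _ _ (Nat.min_le_right _ _) (by omega)] at h1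
    have h2 := Nat.add_left_cancel h1
    rw [← h2]
    refine if_congr ?_ rfl rfl
    simp only [reflIdx]
    omega
  rw [key]
  unfold chiJ pad
  rw [dif_pos hr]
  push_cast
  ring

end Final

/-- Let `A` be a partition of length at most `l` and let the monotone
surjection `f : Fin l → Fin ι` encode a subdivision `J` of `{1,…,l}` into consecutive
intervals (its fibers). Then (i) `G_J(A)` has positive multiplicity in `(s_A)^{L(l)}`, and
(ii) `G_J(A) + χ_J(A)` is a partition with positive multiplicity in `(s_A)^{L(l)-1}`. -/
theorem GJ_in_schur_power (l ι : ℕ) (hl : 0 < l) (A : Fin l → ℕ) (hA : Antitone A)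
    (f : Fin l → Fin ι) (hf : Monotone f) (hsurj : Function.Surjective f) :
    0 < schurMult l (GJ l ι f A) ((schur l A) ^ (Lnum l)) ∧
    (Antitone (fun i => (GJ l ι f A i : ℤ) + chiJ l ι f A i) ∧
      (∀ i, 0 ≤ (GJ l ι f A i : ℤ) + chiJ l ι f A i) ∧
      0 < schurMult l (fun i => ((GJ l ι f A i : ℤ) + chiJ l ι f A i).toNat)
        ((schur l A) ^ (Lnum l - 1))) := by
  have H := blk_f hf
  have e1 : GJ l ι f A = gam (fun c => bstart l ι f (f c)) (fun c => bsize l ι f (f c)) A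
      (Lnum l) := by
    ext c
    rw [gam_GJ hf hA]
  refine ⟨?_, ?_, ?_, ?_⟩
  · rw [e1]
    exact mult_pos H hA _
  · intro c d h
    simp only [gam_chi hf hA]
    exact_mod_cast gam_anti H A _ h
  · intro c
    rw [gam_chi hf hA]
    exact Int.natCast_nonneg _
  · simp only [gam_chi hf hA, Int.toNat_natCast]
    exact mult_pos H hA _
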